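/- If a family {F_n}_{n∈ω} of nonempty closed subsets of a Tychonoff space X is not locally finite at a point x ∉ ⋃_n F_n, and each F_n has a functional neighborhood U_n with {U_n} compact-finite, then the function f = Σ_n n·g_n (with g_n as Urysohn functions witnessing the functional neighborhoods) is unbounded on every neighborhood of x, hence not continuous at x. -/

import Mathlib

/-- If the family {F_n} is not locally finite at x ∉ ⋃ F_n, the sum Σ n·g_n is unbounded on
every neighborhood of x, hence discontinuous at x. -/
theorem stmt14 {X : Type*} [TopologicalSpace X] [CompletelyRegularSpace X] [T1Space X]
    (F U : ℕ → Set X) (x : X)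
    (hFne : ∀ n, (F n).Nonempty) (hFcl : ∀ n, IsClosed (F n)) (hx : x ∉ ⋃ n, F n)
    (hnlf : ∀ V ∈ nhds x, {n | (V ∩ F n).Nonempty}.Infinite)
    (g : ℕ → X → ℝ) (hg : ∀ n, Continuous (g n)) (hg01 : ∀ n y, g n y ∈ Set.Icc (0:ℝ) 1)
    (hgF : ∀ n, ∀ y ∈ F n, g n y = 1) (hgU : ∀ n, ∀ y ∉ U n, g n y = 0)
    (hcf : ∀ K : Set X, IsCompact K → {n | (K ∩ U n).Nonempty}.Finite) :
    (∀ V ∈ nhds x, ∀ M : ℝ, ∃ y ∈ V, (∑' n : ℕ, (n : ℝ) * g n y) ≥ M) ∧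
    ¬ ContinuousAt (fun y => ∑' n : ℕ, (n : ℝ) * g n y) x := by
  have key : ∀ V ∈ nhds x, ∀ M : ℝ, ∃ y ∈ V, (∑' n : ℕ, (n : ℝ) * g n y) ≥ M := by
    intro V hV M
    obtain ⟨N, hN⟩ := exists_nat_ge M
    obtain ⟨n, ⟨y, hyV, hyF⟩, hn⟩ := (hnlf V hV).exists_gt N
    refine ⟨y, hyV, ?_⟩
    have hfin : {n | (({y} : Set X) ∩ U n).Nonempty}.Finite := hcf {y} isCompact_singleton
    have hsum : Summable (fun n : ℕ => (n : ℝ) * g n y) := by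
      apply summable_of_hasFiniteSupport
      refine hfin.subset ?_
      intro m hm
      by_contra hmU
      apply hm
      have : y ∉ U m := fun h => hmU ⟨y, rfl, h⟩
      simp [hgU m y this]
    have h1 : (n : ℝ) * g n y ≤ ∑' n : ℕ, (n : ℝ) * g n y :=
      hsum.le_tsum n (fun m _ => mul_nonneg (Nat.cast_nonneg m) (hg01 m y).1)
    rw [hgF n y hyF, mul_one] at h1
    have h2 : (N : ℝ) < n := by exact_mod_cast hn
    linarith
  refine ⟨key, fun hc => ?_⟩
  have hV := hc.eventually (gt_mem_nhds (lt_add_one _))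
  obtain ⟨y, hy, hyM⟩ := key _ hV ((∑' n : ℕ, (n : ℝ) * g n x) + 1)
  have hy' : (∑' n : ℕ, (n : ℝ) * g n y) < (∑' n : ℕ, (n : ℝ) * g n x) + 1 := hy
  linarith
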